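/- For every positive even integer k, let Γ₂ be the group with presentation ⟨a, b, c, α | [b, a] = c^k, [c, a] = [c, b] = [c, α] = 1, α·a = a⁻¹·α, α·b = b⁻¹·α, α² = c⟩ (where [x, y] = x·y·x⁻¹·y⁻¹). Then there exists an injective group homomorphism φ : Γ₂ → GL(3, ℂ) with φ(a) = ψ(2k, 0), φ(b) = ψ(2ki, 0), φ(c) = ψ(0, 16k), and φ(α) = ψ(0, 8k)·D, where D is the diagonal matrix diag(−1, 1, 1); moreover all matrix entries of φ(a), φ(b), φ(c), φ(α) lie in the ring of Gaussian integers ℤ[i]. -/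

import Mathlib

open Matrix Complex

/-- The matrix `ψ(ξ, t)` realizing the Heisenberg group element `(ξ, t)` in `GL(3, ℂ)`. -/
noncomputable def heisenbergPsi (ξ : ℂ) (t : ℝ) : Matrix (Fin 3) (Fin 3) ℂ :=
  !![1, ξ, ξ;
     -(starRingEnd ℂ ξ), 1 - ((normSq ξ : ℂ) - t * I) / 2, -(((normSq ξ : ℂ) - t * I) / 2);
     starRingEnd ℂ ξ, ((normSq ξ : ℂ) - t * I) / 2, 1 + ((normSq ξ : ℂ) - t * I) / 2]

/-- The relator set for
`Γ₂ = ⟨a, b, c, α | [b,a] = c^k, [c,a] = [c,b] = [c,α] = 1, αa = a⁻¹α, αb = b⁻¹α, α² = c⟩`,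
with generators `a = 0`, `b = 1`, `c = 2`, `α = 3`. -/
def gamma2Rels (k : ℕ) : Set (FreeGroup (Fin 4)) :=
  { FreeGroup.of 1 * FreeGroup.of 0 * (FreeGroup.of 1)⁻¹ * (FreeGroup.of 0)⁻¹ *
      ((FreeGroup.of 2) ^ k)⁻¹,
    FreeGroup.of 2 * FreeGroup.of 0 * (FreeGroup.of 2)⁻¹ * (FreeGroup.of 0)⁻¹,
    FreeGroup.of 2 * FreeGroup.of 1 * (FreeGroup.of 2)⁻¹ * (FreeGroup.of 1)⁻¹,
    FreeGroup.of 2 * FreeGroup.of 3 * (FreeGroup.of 2)⁻¹ * (FreeGroup.of 3)⁻¹,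
    FreeGroup.of 3 * FreeGroup.of 0 * (FreeGroup.of 3)⁻¹ * FreeGroup.of 0,
    FreeGroup.of 3 * FreeGroup.of 1 * (FreeGroup.of 3)⁻¹ * FreeGroup.of 1,
    (FreeGroup.of 3) ^ 2 * (FreeGroup.of 2)⁻¹ }

/-- The product rule of the Heisenberg group. -/
lemma heisenbergPsi_mul (ξ ζ : ℂ) (t s : ℝ) :
    heisenbergPsi ξ t * heisenbergPsi ζ s =
      heisenbergPsi (ξ + ζ) (t + s - 2 * (starRingEnd ℂ ξ * ζ).im) := by
  ext i j
  fin_cases i <;> fin_cases j <;>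
    apply Complex.ext <;>
    simp [heisenbergPsi, Matrix.mul_apply, Fin.sum_univ_three, normSq_apply] <;>
    ring

lemma heisenbergPsi_zero : heisenbergPsi 0 0 = 1 := by
  ext i j
  fin_cases i <;> fin_cases j <;> simp [heisenbergPsi]

lemma heisenbergPsi_injective {ξ ζ : ℂ} {t s : ℝ}
    (h : heisenbergPsi ξ t = heisenbergPsi ζ s) : ξ = ζ ∧ t = s := by
  have h₁ : ξ = ζ := by simpa [heisenbergPsi] using congrFun (congrFun h 0) 1
  subst h₁
  refine ⟨rfl, ?_⟩
  have h₂ := congrArg Complex.im (congrFun (congrFun h 2) 1)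
  simpa [heisenbergPsi] using h₂

/-- The matrix `heisenbergPsi ξ t` as an element of `GL(3, ℂ)`. -/
noncomputable def heisenbergGL (ξ : ℂ) (t : ℝ) : GL (Fin 3) ℂ where
  val := heisenbergPsi ξ t
  inv := heisenbergPsi (-ξ) (-t)
  val_inv := by
    rw [heisenbergPsi_mul, ← heisenbergPsi_zero]
    congr 1 <;> simp [mul_comm]
  inv_val := by
    rw [heisenbergPsi_mul, ← heisenbergPsi_zero]
    congr 1 <;> simp [mul_comm]

lemma heisenbergGL_mul (ξ ζ : ℂ) (t s : ℝ) :
    heisenbergGL ξ t * heisenbergGL ζ s =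
      heisenbergGL (ξ + ζ) (t + s - 2 * (starRingEnd ℂ ξ * ζ).im) :=
  Units.ext (heisenbergPsi_mul ξ ζ t s)

lemma heisenbergGL_inv (ξ : ℂ) (t : ℝ) : (heisenbergGL ξ t)⁻¹ = heisenbergGL (-ξ) (-t) :=
  Units.ext rfl

lemma heisenbergGL_zero : heisenbergGL 0 0 = 1 :=
  Units.ext heisenbergPsi_zero

lemma heisenbergGL_injective {ξ ζ : ℂ} {t s : ℝ}
    (h : heisenbergGL ξ t = heisenbergGL ζ s) : ξ = ζ ∧ t = s :=
  heisenbergPsi_injective (congrArg Units.val h)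

lemma heisenbergGL_zpow (ξ : ℂ) (t : ℝ) (n : ℤ) :
    heisenbergGL ξ t ^ n = heisenbergGL (n * ξ) (n * t) := by
  induction n using Int.induction_on with
  | zero => simp [heisenbergGL_zero]
  | succ n ih =>
    rw [_root_.zpow_add_one, ih, heisenbergGL_mul]
    congr 1
    · push_cast; ring
    · simp; ring
  | pred n ih =>
    rw [_root_.zpow_sub_one, ih, heisenbergGL_inv, heisenbergGL_mul]
    congr 1
    · push_cast; ring
    · simp; ring

/-- The reflection `diag(-1, 1, 1)` as an element of `GL(3, ℂ)`. -/
noncomputable def reflectionGL : GL (Fin 3) ℂ where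
  val := !![-1, 0, 0; 0, 1, 0; 0, 0, 1]
  inv := !![-1, 0, 0; 0, 1, 0; 0, 0, 1]
  val_inv := by
    ext i j
    fin_cases i <;> fin_cases j <;> simp [Matrix.mul_apply, Fin.sum_univ_three]
  inv_val := by
    ext i j
    fin_cases i <;> fin_cases j <;> simp [Matrix.mul_apply, Fin.sum_univ_three]

lemma reflectionGL_mul_self : reflectionGL * reflectionGL = 1 :=
  Units.ext reflectionGL.val_inv

lemma reflectionGL_mul_heisenbergGL (ξ : ℂ) (t : ℝ) :
    reflectionGL * heisenbergGL ξ t = heisenbergGL (-ξ) t * reflectionGL := by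
  ext i j
  fin_cases i <;> fin_cases j <;>
    simp [reflectionGL, heisenbergGL, heisenbergPsi, Matrix.mul_apply, Fin.sum_univ_three]

/-- A normal form for groups generated by elements satisfying the relations of `Γ₂`. -/
lemma exists_zpow_mul_zpow_mul_zpow {G : Type*} [Group G] {k : ℕ} {a b c α : G}
    (hba : b * a * b⁻¹ = c ^ k * a) (hca : Commute c a) (hcb : Commute c b)
    (hαa : α * a * α⁻¹ = a⁻¹) (hαb : α * b * α⁻¹ = b⁻¹) (hα : α ^ 2 = c)
    (g : G) (hg : g ∈ Subgroup.closure ({a, b, c, α} : Set G)) :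
    ∃ m n p : ℤ, g = a ^ m * b ^ n * α ^ p := by
  have hc (q : ℤ) : c ^ q = α ^ (2 * q) := by
    rw [← hα, ← zpow_natCast, ← _root_.zpow_mul]; rfl
  have comm_mul_left (q m n p : ℤ) :
      c ^ q * (a ^ m * b ^ n * α ^ p) = a ^ m * b ^ n * α ^ (2 * q + p) := by
    have h := ((hca.zpow_zpow q m).mul_right (hcb.zpow_zpow q n)).eq
    rw [← mul_assoc, h, mul_assoc, hc, _root_.zpow_add]
  have hbm (m : ℤ) : b * a ^ m = c ^ (k * m) * a ^ m * b := by
    have h : (b * a * b⁻¹) ^ m = c ^ (k * m) * a ^ m := by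
      rw [hba, (hca.pow_left k).mul_zpow, _root_.zpow_mul, zpow_natCast]
    rw [← h, conj_zpow]; group
  have hbm' (m : ℤ) : b⁻¹ * a ^ m = c ^ (-(k * m)) * a ^ m * b⁻¹ := by
    have h₁ : b⁻¹ * c ^ (-(k * m) : ℤ) = c ^ (-(k * m) : ℤ) * b⁻¹ :=
      ((hcb.zpow_left _).inv_right).eq.symm
    calc b⁻¹ * a ^ m = b⁻¹ * c ^ (-(k * m) : ℤ) * (c ^ (k * m : ℤ) * a ^ m * b) * b⁻¹ := by
          group
      _ = c ^ (-(k * m) : ℤ) * a ^ m * b⁻¹ := by rw [← hbm, h₁]; group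
  have hαm (m n : ℤ) : α * (a ^ m * b ^ n) = a ^ (-m) * b ^ (-n) * α := by
    have h₁ := conj_zpow (i := m) (a := α) (b := a)
    have h₂ := conj_zpow (i := n) (a := α) (b := b)
    rw [hαa, _root_.inv_zpow'] at h₁
    rw [hαb, _root_.inv_zpow'] at h₂
    rw [h₁, h₂]; group
  have hαm' (m n : ℤ) : α⁻¹ * (a ^ m * b ^ n) = a ^ (-m) * b ^ (-n) * α⁻¹ := by
    have h := hαm (-m) (-n)
    rw [neg_neg, neg_neg] at h
    rw [inv_mul_eq_iff_eq_mul, ← mul_assoc, h, mul_inv_cancel_right]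
  induction hg using Subgroup.closure_induction_left with
  | one => exact ⟨0, 0, 0, by simp⟩
  | mul_left x hx y _ ih =>
    obtain ⟨m, n, p, rfl⟩ := ih
    rcases hx with rfl | rfl | rfl | rfl
    · exact ⟨1 + m, n, p, by simp only [_root_.zpow_add, zpow_one, mul_assoc]⟩
    · refine ⟨m, 1 + n, 2 * (k * m) + p, ?_⟩
      rw [← comm_mul_left, ← mul_assoc, ← mul_assoc, hbm]
      simp only [_root_.zpow_add, zpow_one, mul_assoc]
    · exact ⟨m, n, 2 * 1 + p, by rw [← comm_mul_left, zpow_one]⟩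
    · refine ⟨-m, -n, 1 + p, ?_⟩
      rw [← mul_assoc, hαm, _root_.zpow_add, zpow_one, mul_assoc]
  | inv_mul_cancel x hx y _ ih =>
    obtain ⟨m, n, p, rfl⟩ := ih
    rcases hx with rfl | rfl | rfl | rfl
    · exact ⟨-1 + m, n, p, by simp only [_root_.zpow_add, _root_.zpow_neg_one, mul_assoc]⟩
    · refine ⟨m, -1 + n, 2 * (-(k * m)) + p, ?_⟩
      rw [← comm_mul_left, ← mul_assoc, ← mul_assoc, hbm']
      simp only [_root_.zpow_add, _root_.zpow_neg_one, mul_assoc]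
    · exact ⟨m, n, 2 * (-1) + p, by rw [← comm_mul_left, _root_.zpow_neg_one]⟩
    · refine ⟨-m, -n, -1 + p, ?_⟩
      rw [← mul_assoc, hαm', _root_.zpow_add, _root_.zpow_neg_one, mul_assoc]

/-- The images in `GL(3, ℂ)` of the generators of `Γ₂`. -/
noncomputable def gamma2Gens (k : ℕ) : Fin 4 → GL (Fin 3) ℂ :=
  ![heisenbergGL (2 * k) 0, heisenbergGL (2 * k * I) 0, heisenbergGL 0 (16 * k),
    heisenbergGL 0 (8 * k) * reflectionGL]

lemma sq_heisenbergGL_mul_reflectionGL (k : ℕ) :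
    (heisenbergGL 0 (8 * k) * reflectionGL) ^ 2 = heisenbergGL 0 (16 * k) := by
  rw [sq, mul_assoc, ← mul_assoc reflectionGL, reflectionGL_mul_heisenbergGL,
    mul_assoc _ reflectionGL, reflectionGL_mul_self, mul_one, heisenbergGL_mul]
  congr 1
  · simp
  · simp; ring

lemma lift_gamma2Gens_eq_one (k : ℕ) :
    ∀ r ∈ gamma2Rels k, FreeGroup.lift (gamma2Gens k) r = 1 := by
  have hc (ξ : ℂ) (t s : ℝ) : Commute (heisenbergGL 0 t) (heisenbergGL ξ s) := by
    rw [commute_iff_eq, heisenbergGL_mul, heisenbergGL_mul]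
    congr 1
    · ring
    · simp; ring
  have hcD (t : ℝ) : Commute (heisenbergGL 0 t) reflectionGL := by
    rw [commute_iff_eq, reflectionGL_mul_heisenbergGL, neg_zero]
  have hα (ξ : ℂ) : heisenbergGL 0 (8 * k) * reflectionGL * heisenbergGL ξ 0 =
      (heisenbergGL ξ 0)⁻¹ * (heisenbergGL 0 (8 * k) * reflectionGL) := by
    rw [mul_assoc, reflectionGL_mul_heisenbergGL, heisenbergGL_inv, neg_zero, ← mul_assoc,
      (hc _ _ _).eq, mul_assoc]
  rintro r (rfl | rfl | rfl | rfl | rfl | rfl | rfl)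
  · simp only [gamma2Gens, map_mul, map_inv, map_pow, FreeGroup.lift_apply_of, cons_val]
    rw [← zpow_natCast, heisenbergGL_zpow]
    simp only [heisenbergGL_inv, heisenbergGL_mul, ← heisenbergGL_zero]
    congr 1
    · simp
    · simp; ring
  · simp [gamma2Gens, (hc _ _ _).eq]
  · simp [gamma2Gens, (hc _ _ _).eq]
  · simp only [gamma2Gens, map_mul, map_inv, FreeGroup.lift_apply_of, cons_val]
    rw [((hc _ _ _).mul_right (hcD _)).eq]
    group
  · simp only [gamma2Gens, map_mul, map_inv, FreeGroup.lift_apply_of, cons_val]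
    rw [hα]
    group
  · simp only [gamma2Gens, map_mul, map_inv, FreeGroup.lift_apply_of, cons_val]
    rw [hα]
    group
  · simp only [gamma2Gens, map_mul, map_inv, map_pow, FreeGroup.lift_apply_of, cons_val]
    rw [sq_heisenbergGL_mul_reflectionGL, mul_inv_cancel]

lemma gamma2_normal_form (k : ℕ) (g : PresentedGroup (gamma2Rels k)) :
    ∃ m n p : ℤ, g = PresentedGroup.of 0 ^ m * PresentedGroup.of 1 ^ n *
      PresentedGroup.of 3 ^ p := by
  have rel {r : FreeGroup (Fin 4)} (hr : r ∈ gamma2Rels k) :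
      PresentedGroup.mk (gamma2Rels k) r = 1 := PresentedGroup.one_of_mem hr
  have h₁ := rel (Or.inl rfl)
  have h₂ := rel (Or.inr (Or.inl rfl))
  have h₃ := rel (Or.inr (Or.inr (Or.inl rfl)))
  have h₅ := rel (Or.inr (Or.inr (Or.inr (Or.inr (Or.inl rfl)))))
  have h₆ := rel (Or.inr (Or.inr (Or.inr (Or.inr (Or.inr (Or.inl rfl))))))
  have h₇ := rel (Or.inr (Or.inr (Or.inr (Or.inr (Or.inr (Or.inr rfl))))))
  have hof (i : Fin 4) :
      PresentedGroup.mk (gamma2Rels k) (FreeGroup.of i) = PresentedGroup.of i := rfl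
  simp only [map_mul, map_inv, map_pow, hof] at h₁ h₂ h₃ h₅ h₆ h₇
  refine exists_zpow_mul_zpow_mul_zpow (k := k) (c := PresentedGroup.of 2) ?_ ?_ ?_
    (eq_inv_of_mul_eq_one_left h₅) (eq_inv_of_mul_eq_one_left h₆) (mul_inv_eq_one.mp h₇) g ?_
  · exact mul_inv_eq_iff_eq_mul.mp (mul_inv_eq_one.mp h₁)
  · exact mul_inv_eq_iff_eq_mul.mp (mul_inv_eq_one.mp h₂)
  · exact mul_inv_eq_iff_eq_mul.mp (mul_inv_eq_one.mp h₃)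
  · have h : Set.range (PresentedGroup.of : Fin 4 → PresentedGroup (gamma2Rels k)) ⊆
        {PresentedGroup.of 0, PresentedGroup.of 1, PresentedGroup.of 2, PresentedGroup.of 3} := by
      rintro _ ⟨i, rfl⟩
      fin_cases i <;> simp
    have hg : g ∈ Subgroup.closure (Set.range PresentedGroup.of) := by
      rw [PresentedGroup.closure_range_of]; trivial
    exact Subgroup.closure_mono h hg

lemma gamma2_toGroup_injective {k : ℕ} (hk : 0 < k) :
    Function.Injective (PresentedGroup.toGroup (lift_gamma2Gens_eq_one k)) := by
  rw [injective_iff_map_eq_one]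
  intro g hg
  obtain ⟨m, n, p, rfl⟩ := gamma2_normal_form k g
  have hk₀ : (k : ℝ) ≠ 0 := by positivity
  simp only [map_mul, map_zpow, PresentedGroup.toGroup.of, gamma2Gens, cons_val] at hg
  have hα (q : ℤ) : (heisenbergGL 0 (8 * k) * reflectionGL) ^ q *
      (heisenbergGL 0 (8 * k) * reflectionGL) ^ q = heisenbergGL 0 (q * (16 * k)) := by
    rw [← (Commute.refl _).mul_zpow, ← sq, sq_heisenbergGL_mul_reflectionGL, heisenbergGL_zpow,
      mul_zero]
  rw [heisenbergGL_zpow, heisenbergGL_zpow, heisenbergGL_mul] at hg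
  have hp := hα p
  rw [← inv_eq_of_mul_eq_one_right hg, heisenbergGL_inv, heisenbergGL_mul] at hp
  have hξ := (heisenbergGL_injective hp).1
  have hm : m = 0 := by
    have := congrArg Complex.re hξ
    simpa [hk.ne'] using this
  have hn : n = 0 := by
    have := congrArg Complex.im hξ
    simpa [hk.ne'] using this
  subst hm hn
  have hp₀ : p = 0 := by
    simpa [hk₀] using (heisenbergGL_injective hp).2.symm
  simp [hp₀]

lemma heisenbergPsi_apply_mem {R : Subring ℂ} {ξ w : ℂ} {t : ℝ} (hξ : ξ ∈ R)
    (hξ' : starRingEnd ℂ ξ ∈ R) (hw : w ∈ R) (h : (normSq ξ : ℂ) - t * I = 2 * w)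
    (i j : Fin 3) : heisenbergPsi ξ t i j ∈ R := by
  have h2 : ((normSq ξ : ℂ) - t * I) / 2 = w := by rw [h]; ring
  rw [heisenbergPsi, h2]
  fin_cases i <;> fin_cases j <;>
    simp [hξ, hξ', hw, R.one_mem, R.neg_mem, R.add_mem, R.sub_mem]

theorem stmt16 (k : ℕ) (hk : 0 < k) (hke : Even k) :
    ∃ φ : PresentedGroup (gamma2Rels k) →* GL (Fin 3) ℂ,
      Function.Injective φ ∧
      (φ (PresentedGroup.of 0) : Matrix (Fin 3) (Fin 3) ℂ) = heisenbergPsi (2 * k) 0 ∧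
      (φ (PresentedGroup.of 1) : Matrix (Fin 3) (Fin 3) ℂ) = heisenbergPsi (2 * k * I) 0 ∧
      (φ (PresentedGroup.of 2) : Matrix (Fin 3) (Fin 3) ℂ) = heisenbergPsi 0 (16 * k) ∧
      (φ (PresentedGroup.of 3) : Matrix (Fin 3) (Fin 3) ℂ) =
        heisenbergPsi 0 (8 * k) * !![(-1 : ℂ), 0, 0; 0, 1, 0; 0, 0, 1] ∧
      ∀ g : Fin 4, ∀ i j : Fin 3,
        (φ (PresentedGroup.of g) : Matrix (Fin 3) (Fin 3) ℂ) i j ∈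
          Subring.closure ({I} : Set ℂ) := by
  have hI : I ∈ Subring.closure ({I} : Set ℂ) := Subring.subset_closure rfl
  have hN (n : ℕ) : (n : ℂ) ∈ Subring.closure ({I} : Set ℂ) := natCast_mem _ n
  have h2 : (2 : ℂ) ∈ Subring.closure ({I} : Set ℂ) := hN 2
  refine ⟨PresentedGroup.toGroup (lift_gamma2Gens_eq_one k), gamma2_toGroup_injective hk,
    ?_, ?_, ?_, ?_, ?_⟩
  · simp [gamma2Gens, heisenbergGL]
  · simp [gamma2Gens, heisenbergGL]
  · simp [gamma2Gens, heisenbergGL]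
  · simp [gamma2Gens, heisenbergGL, reflectionGL]
  intro g i j
  rw [PresentedGroup.toGroup.of]
  fin_cases g
  · refine heisenbergPsi_apply_mem (w := 2 * k * k) ?_ ?_ ?_ ?_ i j
    · exact mul_mem h2 (hN k)
    · simpa [conj_ofNat] using mul_mem h2 (hN k)
    · exact mul_mem (mul_mem h2 (hN k)) (hN k)
    · simp; ring
  · refine heisenbergPsi_apply_mem (w := 2 * k * k) ?_ ?_ ?_ ?_ i j
    · exact mul_mem (mul_mem h2 (hN k)) hI
    · simpa [conj_ofNat] using mul_mem (mul_mem h2 (hN k)) hI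
    · exact mul_mem (mul_mem h2 (hN k)) (hN k)
    · simp; ring
  · refine heisenbergPsi_apply_mem (w := -((8 : ℕ) * k * I)) ?_ ?_ ?_ ?_ i j
    · exact zero_mem _
    · simp
    · exact neg_mem (mul_mem (mul_mem (hN 8) (hN k)) hI)
    · simp; ring
  · have h : ∀ i j, heisenbergPsi 0 (8 * k) i j ∈ Subring.closure ({I} : Set ℂ) := by
      refine heisenbergPsi_apply_mem (w := -((4 : ℕ) * k * I)) (zero_mem _) (by simp) ?_ ?_
      · exact neg_mem (mul_mem (mul_mem (hN 4) (hN k)) hI)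
      · simp; ring
    have hD : ∀ i j, (!![-1, 0, 0; 0, 1, 0; 0, 0, 1] : Matrix (Fin 3) (Fin 3) ℂ) i j ∈
        Subring.closure ({I} : Set ℂ) := by
      intro i j
      fin_cases i <;> fin_cases j <;> simp [one_mem, zero_mem]
    change (heisenbergPsi 0 (8 * k) *
      (!![-1, 0, 0; 0, 1, 0; 0, 0, 1] : Matrix (Fin 3) (Fin 3) ℂ)) i j ∈ _
    rw [Matrix.mul_apply]
    exact sum_mem fun l _ => mul_mem (h i l) (hD l j)
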